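/- Let n be a positive integer and let p₀,…,pₙ ∈ ℝ^{1,n} be (n+1) points in general position. Then the Lorentzian distance-squared mapping L_{(p₀,…,pₙ)} : ℝ^{1,n} → ℝ^{n+1} is A-equivalent to the normal form of definite fold mapping Φₙ(x₀,…,xₙ) = (x₁,…,xₙ, x₀²) if and only if the recognition subspace V(p₀,…,pₙ) is time-like or space-like. -/

import Mathlib

open scoped BigOperators

noncomputable section

/-- The Lorentzian inner product on `ℝ^{1,n}`, modeled as `Fin (n+1) → ℝ`:
`⟨x,y⟩ = -x₀y₀ + x₁y₁ + ⋯ + xₙyₙ`. -/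
def lorIP {n : ℕ} (x y : Fin (n + 1) → ℝ) : ℝ :=
  (∑ i, x i * y i) - 2 * (x 0 * y 0)

/-- The Euclidean inner product on `Fin m → ℝ`. -/
def eucIP {m : ℕ} (x y : Fin m → ℝ) : ℝ := ∑ i, x i * y i

/-- The Lorentzian distance-squared mapping determined by the points `p 0, …, p (m-1)`. -/
def LorDSM {n m : ℕ} (p : Fin m → Fin (n + 1) → ℝ) :
    (Fin (n + 1) → ℝ) → (Fin m → ℝ) :=
  fun x i => lorIP (x - p i) (x - p i)

/-- The Euclidean distance-squared mapping determined by the points `p 0, …, p (m-1)`. -/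
def EucDSM {n m : ℕ} (p : Fin m → Fin (n + 1) → ℝ) :
    (Fin (n + 1) → ℝ) → (Fin m → ℝ) :=
  fun x i => eucIP (x - p i) (x - p i)

/-- The recognition subspace `V(p₀, …, p_k)`: the span of the vectors `p i - p 0`. -/
def recSub {n k : ℕ} (p : Fin (k + 1) → Fin (n + 1) → ℝ) :
    Submodule ℝ (Fin (n + 1) → ℝ) :=
  Submodule.span ℝ (Set.range fun i => p i - p 0)

/-- The partial recognition subspace `V(p₀, …, p_j)`: the span of `p i - p 0` for `i ≤ j`. -/
def recSubUpTo {n k : ℕ} (p : Fin (k + 1) → Fin (n + 1) → ℝ) (j : ℕ) :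
    Submodule ℝ (Fin (n + 1) → ℝ) :=
  Submodule.span ℝ {v | ∃ i : Fin (k + 1), (i : ℕ) ≤ j ∧ v = p i - p 0}

/-- A subspace is time-like iff it contains a vector of negative Lorentzian square. -/
def LTimeLike {n : ℕ} (V : Submodule ℝ (Fin (n + 1) → ℝ)) : Prop :=
  ∃ v ∈ V, lorIP v v < 0

/-- A subspace is space-like iff every nonzero vector in it has positive Lorentzian square. -/
def LSpaceLike {n : ℕ} (V : Submodule ℝ (Fin (n + 1) → ℝ)) : Prop :=
  ∀ v ∈ V, v ≠ 0 → 0 < lorIP v v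

/-- A subspace is light-like iff it is neither time-like nor space-like. -/
def LLightLike {n : ℕ} (V : Submodule ℝ (Fin (n + 1) → ℝ)) : Prop :=
  ¬ LTimeLike V ∧ ¬ LSpaceLike V

/-- `f` and `g` are `𝒜`-equivalent: `g = H ∘ f ∘ h` for `C^∞` diffeomorphisms `h, H`. -/
def AEquiv {a b : ℕ} (f g : (Fin a → ℝ) → (Fin b → ℝ)) : Prop :=
  ∃ (h : (Fin a → ℝ) ≃ (Fin a → ℝ)) (H : (Fin b → ℝ) ≃ (Fin b → ℝ)),
    ContDiff ℝ (⊤ : ℕ∞) ⇑h ∧ ContDiff ℝ (⊤ : ℕ∞) ⇑h.symm ∧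
    ContDiff ℝ (⊤ : ℕ∞) ⇑H ∧ ContDiff ℝ (⊤ : ℕ∞) ⇑H.symm ∧
    g = ⇑H ∘ f ∘ ⇑h

/-- The Lorentzian inner product as a bilinear form. -/
def lorForm (n : ℕ) : LinearMap.BilinForm ℝ (Fin (n + 1) → ℝ) :=
  LinearMap.mk₂ ℝ lorIP
    (fun x y z => by simp only [lorIP, Pi.add_apply, add_mul, Finset.sum_add_distrib]; ring)
    (fun c x y => by
      simp only [lorIP, Pi.smul_apply, smul_eq_mul, mul_assoc, ← Finset.mul_sum]; ring)
    (fun x y z => by simp only [lorIP, Pi.add_apply, mul_add, Finset.sum_add_distrib]; ring)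
    (fun c x y => by
      simp only [lorIP, Pi.smul_apply, smul_eq_mul, mul_left_comm _ c, ← Finset.mul_sum]; ring)

theorem lorForm_apply {n : ℕ} (x y : Fin (n + 1) → ℝ) : lorForm n x y = lorIP x y := rfl

theorem lorForm_comm {n : ℕ} (x y : Fin (n + 1) → ℝ) : lorForm n x y = lorForm n y x := by
  simp only [lorForm_apply, lorIP, mul_comm]

theorem lorForm_eq_sum_succ {n : ℕ} (x y : Fin (n + 1) → ℝ) :
    lorForm n x y = (∑ i : Fin n, x i.succ * y i.succ) - x 0 * y 0 := by
  rw [lorForm_apply, lorIP, Fin.sum_univ_succ]; ring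

theorem lorForm_add_self {n : ℕ} (x y : Fin (n + 1) → ℝ) :
    lorForm n (x + y) (x + y) = lorForm n x x + 2 * lorForm n x y + lorForm n y y := by
  rw [map_add, map_add, LinearMap.add_apply, LinearMap.add_apply, lorForm_comm y x]; ring

theorem lorForm_sub_self {n : ℕ} (x y : Fin (n + 1) → ℝ) :
    lorForm n (x - y) (x - y) = lorForm n x x - 2 * lorForm n x y + lorForm n y y := by
  rw [map_sub, map_sub, LinearMap.sub_apply, LinearMap.sub_apply, lorForm_comm y x]; ring

theorem contDiff_lorForm_self (n : ℕ) :
    ContDiff ℝ (⊤ : ℕ∞) fun x : Fin (n + 1) → ℝ => lorForm n x x := by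
  simp only [lorForm_apply, lorIP]; fun_prop

/-- The Lorentzian form is nondegenerate. -/
theorem eq_zero_of_forall_lorForm_eq_zero {n : ℕ} {x : Fin (n + 1) → ℝ}
    (h : ∀ y, lorForm n x y = 0) : x = 0 := by
  have hs := h (Fin.cons (-x 0) fun i => x i.succ)
  simp only [lorForm_eq_sum_succ, Fin.cons_succ, Fin.cons_zero] at hs
  have hn : 0 ≤ ∑ i : Fin n, x i.succ * x i.succ :=
    Finset.sum_nonneg fun i _ => mul_self_nonneg _
  have h0 : x 0 = 0 := by nlinarith [mul_self_nonneg (x 0)]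
  have hz : ∑ i : Fin n, x i.succ * x i.succ = 0 := by rw [h0] at hs; linarith
  rw [Finset.sum_eq_zero_iff_of_nonneg fun i _ => mul_self_nonneg _] at hz
  funext i
  refine Fin.cases h0 (fun j => ?_) i
  exact mul_self_eq_zero.mp (hz j (Finset.mem_univ j))

/-- A nonzero vector orthogonal to a time-like vector is not light-like. -/
theorem lorForm_self_ne_zero_of_orthogonal {n : ℕ} {t u : Fin (n + 1) → ℝ}
    (ht : lorForm n t t < 0) (hu : u ≠ 0) (hut : lorForm n u t = 0) : lorForm n u u ≠ 0 := by
  intro huu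
  have cs := Finset.sum_mul_sq_le_sq_mul_sq Finset.univ
    (fun i : Fin n => u i.succ) (fun i : Fin n => t i.succ)
  simp only [lorForm_eq_sum_succ, ← sq] at ht huu hut
  rw [sub_eq_zero] at huu hut
  rw [hut, huu] at cs
  by_cases h0 : u 0 = 0
  · rw [h0, zero_pow two_ne_zero, Finset.sum_eq_zero_iff_of_nonneg fun i _ => sq_nonneg _] at huu
    refine hu (funext fun i => Fin.cases h0 (fun j => ?_) i)
    exact pow_eq_zero_iff two_ne_zero |>.mp (huu j (Finset.mem_univ j))
  · have : 0 < u 0 ^ 2 := by positivity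
    nlinarith

theorem sup_span_singleton_eq_top_of_notMem {n : ℕ} {V : Submodule ℝ (Fin (n + 1) → ℝ)}
    {u : Fin (n + 1) → ℝ} (hV : Module.finrank ℝ V = n) (hu : u ∉ V) : V ⊔ ℝ ∙ u = ⊤ := by
  have hlt : V < V ⊔ ℝ ∙ u := left_lt_sup.mpr fun hle =>
    hu (hle (Submodule.mem_span_singleton_self u))
  have hfr := Submodule.finrank_lt_finrank_of_lt hlt
  refine Submodule.eq_top_of_finrank_eq (le_antisymm (Submodule.finrank_le _) ?_)
  rw [Module.finrank_fin_fun]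
  omega

theorem sub_mem_recSub {n k : ℕ} (p : Fin (k + 1) → Fin (n + 1) → ℝ) (i : Fin (k + 1)) :
    p i - p 0 ∈ recSub p :=
  Submodule.subset_span ⟨i, rfl⟩

/-- A vector orthogonal to every `p i - p 0` is orthogonal to the recognition subspace. -/
theorem lorForm_eq_zero_of_mem_recSub {n k : ℕ} {p : Fin (k + 1) → Fin (n + 1) → ℝ}
    {x : Fin (n + 1) → ℝ} (h : ∀ i : Fin k, lorForm n x (p i.succ - p 0) = 0) :
    ∀ v ∈ recSub p, lorForm n x v = 0 := by
  have : recSub p ≤ LinearMap.ker (lorForm n x) := by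
    refine Submodule.span_le.mpr ?_
    rintro _ ⟨i, rfl⟩
    refine Fin.cases ?_ (fun j => ?_) i
    · simp
    · exact h j
  exact fun v hv => this hv

theorem exists_ne_zero_orthogonal {n : ℕ} (p : Fin (n + 1) → Fin (n + 1) → ℝ) :
    ∃ u ≠ 0, ∀ v ∈ recSub p, lorForm n u v = 0 := by
  let T : (Fin (n + 1) → ℝ) →ₗ[ℝ] (Fin n → ℝ) :=
    LinearMap.pi fun i => (lorForm n).flip (p i.succ - p 0)
  obtain ⟨u, hu, hne⟩ := (Submodule.ne_bot_iff _).mp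
    (LinearMap.ker_ne_bot_of_finrank_lt (f := T) (by simp))
  exact ⟨u, hne, lorForm_eq_zero_of_mem_recSub fun i => congrFun hu i⟩

/-- A time-like or space-like recognition subspace has a normal vector that is not light-like. -/
theorem exists_nonnull_normal {n : ℕ} {p : Fin (n + 1) → Fin (n + 1) → ℝ}
    (hV : LTimeLike (recSub p) ∨ LSpaceLike (recSub p))
    (hgen : Module.finrank ℝ (recSub p) = n) :
    ∃ u, lorForm n u u ≠ 0 ∧ ∀ v ∈ recSub p, lorForm n u v = 0 := by
  obtain ⟨u, hne, hu⟩ := exists_ne_zero_orthogonal p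
  refine ⟨u, ?_, hu⟩
  rcases hV with ⟨t, htV, ht⟩ | hs
  · exact lorForm_self_ne_zero_of_orthogonal ht hne (hu t htV)
  · intro huu
    have huV : u ∉ recSub p := fun hmem => (hs u hmem hne).ne' huu
    refine hne (eq_zero_of_forall_lorForm_eq_zero fun y => ?_)
    have hy : y ∈ recSub p ⊔ ℝ ∙ u := by
      rw [sup_span_singleton_eq_top_of_notMem hgen huV]; trivial
    obtain ⟨v, hv, w, hw, rfl⟩ := Submodule.mem_sup.mp hy
    obtain ⟨c, rfl⟩ := Submodule.mem_span_singleton.mp hw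
    rw [map_add, map_smul, hu v hv, huu, smul_zero, add_zero]

/-- The coordinates of a vector with respect to a normal vector and the recognition subspace. -/
def normalCoord {n : ℕ} (p : Fin (n + 1) → Fin (n + 1) → ℝ) (u : Fin (n + 1) → ℝ) :
    (Fin (n + 1) → ℝ) →ₗ[ℝ] (Fin (n + 1) → ℝ) :=
  LinearMap.pi (Fin.cons ((lorForm n).flip u) fun i => (lorForm n).flip (p i.succ - p 0))

theorem normalCoord_zero {n : ℕ} (p : Fin (n + 1) → Fin (n + 1) → ℝ) (u z : Fin (n + 1) → ℝ) :
    normalCoord p u z 0 = lorForm n z u := rfl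

theorem normalCoord_succ {n : ℕ} (p : Fin (n + 1) → Fin (n + 1) → ℝ) (u z : Fin (n + 1) → ℝ)
    (i : Fin n) : normalCoord p u z i.succ = lorForm n z (p i.succ - p 0) := rfl

theorem normalCoord_injective {n : ℕ} {p : Fin (n + 1) → Fin (n + 1) → ℝ}
    {u : Fin (n + 1) → ℝ} (hgen : Module.finrank ℝ (recSub p) = n) (huu : lorForm n u u ≠ 0)
    (hu : ∀ v ∈ recSub p, lorForm n u v = 0) : Function.Injective (normalCoord p u) := by
  refine (injective_iff_map_eq_zero _).mpr fun z hz => ?_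
  refine eq_zero_of_forall_lorForm_eq_zero fun y => ?_
  have hy : y ∈ recSub p ⊔ ℝ ∙ u := by
    rw [sup_span_singleton_eq_top_of_notMem hgen fun hmem => huu (hu u hmem)]; trivial
  obtain ⟨v, hv, w, hw, rfl⟩ := Submodule.mem_sup.mp hy
  obtain ⟨c, rfl⟩ := Submodule.mem_span_singleton.mp hw
  have hzv := lorForm_eq_zero_of_mem_recSub (fun i => congrFun hz i.succ) v hv
  have hzu : lorForm n z u = 0 := congrFun hz 0
  rw [map_add, map_smul, hzv, hzu, smul_zero, add_zero]

/-- The polynomial change of target coordinates bringing a distance-squared mapping to its normal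
form. -/
def foldTarget {n : ℕ} (c : Fin n → ℝ) (q : (Fin n → ℝ) → ℝ) (a : ℝ) (ha : a ≠ 0) :
    (Fin (n + 1) → ℝ) ≃ (Fin (n + 1) → ℝ) where
  toFun z := Fin.snoc (α := fun _ => ℝ) (fun i => (z 0 + c i - z i.succ) / 2)
    (a * (z 0 - q fun i => (z 0 + c i - z i.succ) / 2))
  invFun w := Fin.cons (α := fun _ => ℝ) (w (Fin.last n) / a + q fun i => w i.castSucc)
    fun i => (w (Fin.last n) / a + q fun i => w i.castSucc) + c i - 2 * w i.castSucc
  left_inv z := by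
    funext i
    refine Fin.cases ?_ (fun j => ?_) i
    · simp [ha]
    · simp [ha]
      ring
  right_inv w := by
    funext i
    refine Fin.lastCases ?_ (fun j => ?_) i <;> simp <;> field_simp

theorem contDiff_foldTarget {n : ℕ} (c : Fin n → ℝ) {q : (Fin n → ℝ) → ℝ}
    (hq : ContDiff ℝ (⊤ : ℕ∞) q) (a : ℝ) (ha : a ≠ 0) :
    ContDiff ℝ (⊤ : ℕ∞) (foldTarget c q a ha) := by
  refine contDiff_pi.mpr fun i => ?_
  refine Fin.lastCases ?_ (fun j => ?_) i <;> simp [foldTarget] <;> fun_prop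

theorem contDiff_foldTarget_symm {n : ℕ} (c : Fin n → ℝ) {q : (Fin n → ℝ) → ℝ}
    (hq : ContDiff ℝ (⊤ : ℕ∞) q) (a : ℝ) (ha : a ≠ 0) :
    ContDiff ℝ (⊤ : ℕ∞) (foldTarget c q a ha).symm := by
  refine contDiff_pi.mpr fun i => ?_
  refine Fin.cases ?_ (fun j => ?_) i <;> simp [foldTarget] <;> fun_prop

/-- The normal form `(x₁, …, xₙ, x₀²)` of a definite fold mapping. -/
def definiteFold (n : ℕ) (x : Fin (n + 1) → ℝ) : Fin (n + 1) → ℝ :=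
  Fin.snoc (α := fun _ => ℝ) (fun i => x i.succ) (x 0 ^ 2)

theorem definiteFold_eq (n : ℕ) :
    (fun (x : Fin (n + 1) → ℝ) (i : Fin (n + 1)) =>
      if h : (i : ℕ) < n then x ⟨(i : ℕ) + 1, by omega⟩ else x 0 ^ 2) = definiteFold n := by
  funext x i
  refine Fin.lastCases ?_ (fun j => ?_) i
  · simp [definiteFold]
  · simp only [definiteFold, Fin.snoc_castSucc, Fin.val_castSucc, j.isLt, dif_pos]
    rfl

theorem lorDSM_apply {n m : ℕ} (p : Fin m → Fin (n + 1) → ℝ) (x : Fin (n + 1) → ℝ) (i : Fin m) :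
    LorDSM p x i = lorForm n (x - p i) (x - p i) := rfl

theorem aEquiv_definiteFold_of_nonnull_normal {n : ℕ} {p : Fin (n + 1) → Fin (n + 1) → ℝ}
    {u : Fin (n + 1) → ℝ} (hgen : Module.finrank ℝ (recSub p) = n) (huu : lorForm n u u ≠ 0)
    (hu : ∀ v ∈ recSub p, lorForm n u v = 0) : AEquiv (LorDSM p) (definiteFold n) := by
  let e := LinearEquiv.ofInjectiveEndo (normalCoord p u) (normalCoord_injective hgen huu hu)
  have he : ∀ z, e z = normalCoord p u z := fun z => rfl
  have hes : ContDiff ℝ (⊤ : ℕ∞) e.symm :=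
    (LinearMap.toContinuousLinearMap e.symm.toLinearMap).contDiff
  have hec : ContDiff ℝ (⊤ : ℕ∞) e := (LinearMap.toContinuousLinearMap e.toLinearMap).contDiff
  let c : Fin n → ℝ := fun i => lorForm n (p i.succ - p 0) (p i.succ - p 0)
  let lift : (Fin n → ℝ) → Fin (n + 1) → ℝ := fun y => e.symm (Fin.cons (α := fun _ => ℝ) 0 y)
  let q : (Fin n → ℝ) → ℝ := fun y => lorForm n (lift y) (lift y)
  have hq : ContDiff ℝ (⊤ : ℕ∞) q := by
    refine (contDiff_lorForm_self n).comp (hes.comp (contDiff_pi.mpr fun i => ?_))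
    refine Fin.cases ?_ (fun j => ?_) i <;> simp <;> fun_prop
  refine ⟨e.symm.toEquiv.trans (Equiv.addRight (p 0)), foldTarget c q _ huu,
    hes.add contDiff_const, hec.comp (contDiff_id.add contDiff_const),
    contDiff_foldTarget c hq _ huu, contDiff_foldTarget_symm c hq _ huu, ?_⟩
  funext y
  obtain ⟨z, rfl⟩ := e.surjective y
  have h0 : LorDSM p (z + p 0) 0 = lorForm n z z := by
    rw [lorDSM_apply, add_sub_cancel_right]
  have hs : ∀ i : Fin n, (LorDSM p (z + p 0) 0 + c i - LorDSM p (z + p 0) i.succ) / 2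
      = e z i.succ := fun i => by
    rw [h0, lorDSM_apply, show z + p 0 - p i.succ = z - (p i.succ - p 0) by abel,
      lorForm_sub_self, he, normalCoord_succ]
    ring
  have hdecomp : z = lift (fun i => e z i.succ) + (lorForm n z u / lorForm n u u) • u := by
    apply e.injective
    rw [map_add, map_smul, e.apply_symm_apply]
    funext i
    refine Fin.cases ?_ (fun j => ?_) i
    · simp [he, normalCoord_zero, huu]
    · simp only [Pi.add_apply, Fin.cons_succ, Pi.smul_apply, he u, normalCoord_succ,
        hu _ (sub_mem_recSub p j.succ), smul_zero, add_zero]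
  have hlift : lorForm n (lift fun i => e z i.succ) u = 0 := by
    rw [← normalCoord_zero p, ← he, e.apply_symm_apply, Fin.cons_zero]
  have hzz : lorForm n z z = q (fun i => e z i.succ) + lorForm n z u ^ 2 / lorForm n u u := by
    conv_lhs => rw [hdecomp, lorForm_add_self]
    simp only [map_smul, LinearMap.smul_apply, hlift, smul_eq_mul, q]
    field_simp
    ring
  have hfold : foldTarget c q _ huu (LorDSM p (z + p 0)) = definiteFold n (e z) := by
    simp only [foldTarget, Equiv.coe_fn_mk, hs, definiteFold]
    rw [h0, hzz, he z, normalCoord_zero]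
    congr 1
    field_simp
    ring
  simpa using hfold.symm

/-- A light-like subspace is orthogonal to a nonzero null vector. -/
theorem exists_null_orthogonal_of_lightLike {n : ℕ} {V : Submodule ℝ (Fin (n + 1) → ℝ)}
    (hV : LLightLike V) :
    ∃ v ≠ 0, lorForm n v v = 0 ∧ ∀ w ∈ V, lorForm n v w = 0 := by
  obtain ⟨ht, hs⟩ := hV
  simp only [LTimeLike, LSpaceLike, ← lorForm_apply] at ht hs
  push Not at ht hs
  obtain ⟨v, hv, hne, hle⟩ := hs
  have hvv : lorForm n v v = 0 := le_antisymm hle (ht v hv)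
  refine ⟨v, hne, hvv, fun w hw => ?_⟩
  by_contra hvw
  have h := ht _ (V.add_mem hw (V.smul_mem (-(lorForm n w w + 1) / (2 * lorForm n v w)) hv))
  rw [lorForm_add_self] at h
  simp only [map_smul, LinearMap.smul_apply, smul_eq_mul, hvv, mul_zero, add_zero,
    lorForm_comm w v] at h
  field_simp at h
  linarith

theorem definiteFold_eq_of_ne {n : ℕ} {x y z : Fin (n + 1) → ℝ}
    (hxy : definiteFold n x = definiteFold n y) (hxz : definiteFold n x = definiteFold n z)
    (hne : x ≠ y) (hne' : x ≠ z) : y = z := by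
  have key : ∀ {w}, definiteFold n x = definiteFold n w → x ≠ w →
      w 0 = -x 0 ∧ ∀ i : Fin n, w i.succ = x i.succ := fun {w} h hw => by
    have hsucc : ∀ i : Fin n, w i.succ = x i.succ := fun i => by
      simpa [definiteFold] using (congrFun h i.castSucc).symm
    have hsq : x 0 ^ 2 = w 0 ^ 2 := by simpa [definiteFold] using congrFun h (Fin.last n)
    refine ⟨?_, hsucc⟩
    rcases sq_eq_sq_iff_eq_or_eq_neg.mp hsq with h0 | h0
    · exact absurd (funext fun i => Fin.cases h0 (fun j => (hsucc j).symm) i) hw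
    · rw [h0, neg_neg]
  obtain ⟨hy, hy'⟩ := key hxy hne
  obtain ⟨hz, hz'⟩ := key hxz hne'
  exact funext fun i => Fin.cases (hy.trans hz.symm) (fun j => (hy' j).trans (hz' j).symm) i

theorem not_aEquiv_definiteFold_of_lightLike {n : ℕ} {p : Fin (n + 1) → Fin (n + 1) → ℝ}
    (hV : LLightLike (recSub p)) : ¬ AEquiv (LorDSM p) (definiteFold n) := by
  rintro ⟨h, H, -, -, -, -, hfg⟩
  obtain ⟨v, hne, hvv, hv⟩ := exists_null_orthogonal_of_lightLike hV
  have hline : ∀ s : ℝ, LorDSM p (p 0 + s • v) = LorDSM p (p 0) := fun s => by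
    funext i
    have hi := hv _ (sub_mem_recSub p i)
    rw [← neg_sub, map_neg, neg_eq_zero] at hi
    rw [lorDSM_apply, lorDSM_apply, add_sub_right_comm, lorForm_add_self]
    simp only [map_smul, LinearMap.smul_apply, lorForm_comm _ v, hi, hvv, smul_zero, mul_zero,
      add_zero]
  have hfiber : ∀ s : ℝ,
      definiteFold n (h.symm (p 0)) = definiteFold n (h.symm (p 0 + s • v)) := fun s => by
    simp [hfg, hline]
  have hoff : ∀ s : ℝ, s ≠ 0 → h.symm (p 0) ≠ h.symm (p 0 + s • v) := fun s hs heq => by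
    have := h.symm.injective heq
    simp [hs, hne] at this
  have heq := h.symm.injective (definiteFold_eq_of_ne (hfiber 1) (hfiber 2)
    (hoff 1 one_ne_zero) (hoff 2 two_ne_zero))
  have h12 : (1 : ℝ) = 2 := smul_left_injective ℝ hne (add_left_cancel heq)
  norm_num at h12

theorem theorem1_2a (n : ℕ) (hn : 1 ≤ n)
    (p : Fin (n + 1) → Fin (n + 1) → ℝ)
    (hgen : Module.finrank ℝ (recSub p) = n) :
    AEquiv (LorDSM p)
        (fun (x : Fin (n + 1) → ℝ) (i : Fin (n + 1)) =>
          if h : (i : ℕ) < n then x ⟨(i : ℕ) + 1, by omega⟩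
          else x 0 ^ 2)
      ↔ (LTimeLike (recSub p) ∨ LSpaceLike (recSub p)) := by
  rw [definiteFold_eq]
  constructor
  · intro hA
    by_contra hV
    exact not_aEquiv_definiteFold_of_lightLike (not_or.mp hV) hA
  · intro hV
    obtain ⟨u, huu, hu⟩ := exists_nonnull_normal hV hgen
    exact aEquiv_definiteFold_of_nonnull_normal hgen huu hu
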